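/- There is an absolute constant C such that for every integer n ≥ 2 that is a power of two and every power of two α with 1 ≤ α ≤ log₂ n, there is a deterministic online sorting algorithm with known range that uses an array with at most (n/α)·log₂(n/α) + n ≤ C·n·log₂ n/α middle cells and has cost at most C·α·log₂ n on every sequence of n elements of [0,1]. -/

import Mathlib

/-!
Online sorting with known range (see stmt_0 for the model).

STATEMENT 3: there is an absolute constant `C` such that for every power of two `n = 2^k ≥ 2`
and every power of two `α = 2^j` with `1 ≤ α ≤ log₂ n` (i.e. `2^j ≤ k`), there is a
deterministic online algorithm using `m ≤ (n/α) log₂(n/α) + n ≤ C n log₂ n / α` middle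
cells whose cost is at most `C α log₂ n` on every input of `n` elements of `[0,1]`.
-/

noncomputable section
attribute [local instance] Classical.propDecidable

/-- Cost of a configuration `g` of optional values in cells `0, …, N-1`: the sum of
`|x - y|` over all pairs of values occupying consecutive non-empty cells. -/
def configCost {N : ℕ} (g : Fin N → Option ℝ) : ℝ :=
  ∑ i : Fin N, ∑ j : Fin N,
    if (g i).isSome = true ∧ (g j).isSome = true ∧ i < j ∧
        (∀ k : Fin N, i < k → k < j → g k = none) then
      |(g i).getD 0 - (g j).getD 0|
    else 0

/-- The cell in which the deterministic online algorithm `strat` (which sees exactly the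
elements revealed so far) places the `t`-th element of the input sequence `a`. -/
def place {n m : ℕ} (strat : List ℝ → Fin m) (a : Fin n → ℝ) (t : Fin n) : Fin m :=
  strat ((List.ofFn a).take (t.1 + 1))

/-- The final configuration of the array with `m` middle cells and sentinels `0` and `1`
at the two ends, when element `a t` has been placed in middle cell `pl t`. -/
def withSentinels {n m : ℕ} (a : Fin n → ℝ) (pl : Fin n → Fin m) :
    Fin (m + 2) → Option ℝ := fun i =>
  if i.1 = 0 then some 0
  else if i.1 = m + 1 then some 1
  else if h : ∃ t, (pl t).1 + 1 = i.1 then some (a h.choose) else none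

def Hh (L p : ℕ) : ℕ := min (p / 2 ^ L + 1) L

def Emp (S : Finset (ℕ × ℕ)) (h p : ℕ) : Prop := ∀ x ∈ S, x.1 / 2 ^ h ≠ p / 2 ^ h

def Bel (L : ℕ) (S : Finset (ℕ × ℕ)) (g p v : ℕ) : Prop :=
  (g = Hh L p ∧ (p % 2 ^ L) / 2 ^ g = v) ∨
  (g < Hh L p ∧ ∃ x ∈ S, x.1 / 2 ^ g = p / 2 ^ g ∧ x.2 / 2 ^ g = v)

def Avail (L R : ℕ) (S : Finset (ℕ × ℕ)) (q h p : ℕ) : Prop :=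
  p / 2 ^ L < R ∧ Emp S h p ∧ Bel L S (h + 1) p (q / 2 ^ (h + 1))

structure SInv (L R : ℕ) (S : Finset (ℕ × ℕ)) : Prop where
  hp : ∀ x ∈ S, x.1 / 2 ^ L < R
  hq : ∀ x ∈ S, x.2 < 2 ^ L
  i1 : ∀ x ∈ S, (x.1 % 2 ^ L) / 2 ^ (Hh L x.1) = x.2 / 2 ^ (Hh L x.1)
  i2 : ∀ x ∈ S, ∀ y ∈ S, ∀ g, g < Hh L x.1 → x.1 / 2 ^ g = y.1 / 2 ^ g →
    x.2 / 2 ^ g = y.2 / 2 ^ g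
  i3 : ∀ g x y v, g + 1 < L → x / 2 ^ L < R → y / 2 ^ L < R →
    x / 2 ^ (g + 1) ≠ y / 2 ^ (g + 1) → Bel L S (g + 1) x v → Bel L S (g + 1) y v →
    Emp S g x → Emp S g y → False

lemma div_up {p p' a b : ℕ} (h : p / 2 ^ a = p' / 2 ^ a) (hab : a ≤ b) :
    p / 2 ^ b = p' / 2 ^ b := by
  obtain ⟨c, rfl⟩ := Nat.exists_eq_add_of_le hab
  rw [pow_add, ← Nat.div_div_eq_div_mul, ← Nat.div_div_eq_div_mul, h]

lemma mod_div {p a L : ℕ} (h : a ≤ L) : (p % 2 ^ L) / 2 ^ a = (p / 2 ^ a) % 2 ^ (L - a) := by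
  obtain ⟨c, rfl⟩ := Nat.exists_eq_add_of_le h
  rw [pow_add, Nat.mod_mul_right_div_self]; simp

lemma mod_up {p p' a L : ℕ} (h : p / 2 ^ a = p' / 2 ^ a) (hab : a ≤ L) :
    (p % 2 ^ L) / 2 ^ a = (p' % 2 ^ L) / 2 ^ a := by
  rw [mod_div hab, mod_div hab, h]

lemma Hh_le (L p : ℕ) : Hh L p ≤ L := min_le_right _ _

lemma Hh_congr {L p p' a : ℕ} (h : p / 2 ^ a = p' / 2 ^ a) (hab : a ≤ L) : Hh L p = Hh L p' := by
  unfold Hh; rw [div_up h hab]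

lemma Inv_empty (L R : ℕ) : SInv L R ∅ := by
  constructor
  · simp
  · simp
  · simp
  · simp
  · intro g x y v hg hx hy hxy bx bY _ _
    rcases bx with ⟨h1, h2⟩ | ⟨_, x, hx, _⟩
    · rcases bY with ⟨h3, h4⟩ | ⟨_, x, hx, _⟩
      · apply hxy
        have e1 : x / 2 ^ L = g := by unfold Hh at h1; omega
        have e2 : y / 2 ^ L = g := by unfold Hh at h3; omega
        have hx1 := Nat.div_add_mod x (2 ^ L)
        have hy1 := Nat.div_add_mod y (2 ^ L)
        rw [e1] at hx1
        rw [e2] at hy1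
        have hd : 2 ^ (g + 1) ∣ 2 ^ L * g := Dvd.dvd.mul_right (pow_dvd_pow 2 (by omega)) _
        rw [← hx1, ← hy1, Nat.add_div_of_dvd_right hd, Nat.add_div_of_dvd_right hd, h2, h4]
      · simp at hx
    · simp at hx

lemma Inv_step {L R : ℕ} {S : Finset (ℕ × ℕ)} (hS : SInv L R S) {q h p : ℕ} (hq : q < 2 ^ L)
    (hA : Avail L R S q h p) (hmin : ∀ h' < h, ∀ p', ¬ Avail L R S q h' p') :
    SInv L R (insert (p, q) S) := by
  obtain ⟨hpR, hE, hB⟩ := hA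
  have hle : h + 1 ≤ Hh L p := by
    rcases hB with ⟨h1, _⟩ | ⟨h1, _⟩ <;> omega
  have hle' := Hh_le L p
  have key : ∀ y ∈ S, ∀ g, g < Hh L p → p / 2 ^ g = y.1 / 2 ^ g → q / 2 ^ g = y.2 / 2 ^ g := by
    intro y hy g hg hpy
    by_cases hgh : g ≤ h
    · exact absurd (div_up hpy hgh).symm (hE y hy)
    · rcases hB with ⟨h1, _⟩ | ⟨h1, z, hz, hz1, hz2⟩
      · omega
      · have a1 : z.1 / 2 ^ g = p / 2 ^ g := div_up hz1 (by omega)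
        have a2 : z.2 / 2 ^ g = q / 2 ^ g := div_up hz2 (by omega)
        rw [← a2]
        refine hS.i2 z hz y hy g ?_ (a1.trans hpy)
        rw [Hh_congr a1 (by omega)]; exact hg
  constructor
  · intro x hx
    rcases Finset.mem_insert.1 hx with rfl | hx
    · exact hpR
    · exact hS.hp x hx
  · intro x hx
    rcases Finset.mem_insert.1 hx with rfl | hx
    · exact hq
    · exact hS.hq x hx
  · intro x hx
    rcases Finset.mem_insert.1 hx with rfl | hx
    · rcases hB with ⟨h1, h2⟩ | ⟨h1, z, hz, hz1, hz2⟩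
      · dsimp only; rw [← h1]; exact h2
      · dsimp only
        have a0 : Hh L z.1 = Hh L p := Hh_congr hz1 (by omega)
        have a1 : z.1 / 2 ^ (Hh L p) = p / 2 ^ (Hh L p) := div_up hz1 (by omega)
        have a2 : z.2 / 2 ^ (Hh L p) = q / 2 ^ (Hh L p) := div_up hz2 (by omega)
        have := hS.i1 z hz
        rw [a0] at this
        rw [← a2, ← this]
        exact mod_up a1.symm hle'
    · exact hS.i1 x hx
  · intro x hx y hy g hg hxy
    rcases Finset.mem_insert.1 hx with rfl | hx
    · rcases Finset.mem_insert.1 hy with rfl | hy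
      · rfl
      · exact key y hy g hg hxy
    · rcases Finset.mem_insert.1 hy with rfl | hy
      · have := Hh_le L x.1
        exact (key x hx g (by rw [← Hh_congr hxy (by omega)]; exact hg) hxy.symm).symm
      · exact hS.i2 x hx y hy g hg hxy
  · -- i3
    have aux : ∀ g x y v, g + 1 < L → x / 2 ^ L < R → y / 2 ^ L < R →
        x / 2 ^ (g + 1) ≠ y / 2 ^ (g + 1) → Bel L (insert (p, q) S) (g + 1) x v →
        Bel L (insert (p, q) S) (g + 1) y v → Emp S g x → Emp S g y →
        ¬ Bel L S (g + 1) x v → False := by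
      intro g x y v hg hx hy hxy bx bY ex ey nb
      rcases bx with h1 | ⟨h1, z, hz, hz1, hz2⟩
      · exact nb (Or.inl h1)
      rcases Finset.mem_insert.1 hz with rfl | hz
      swap
      · exact nb (Or.inr ⟨h1, z, hz, hz1, hz2⟩)
      dsimp only at hz1 hz2
      have hH : Hh L p = Hh L x := Hh_congr hz1 (by omega)
      by_cases hgh : h + 1 ≤ g + 1
      · rcases hB with ⟨h3, _⟩ | ⟨h3, w, hw, hw1, hw2⟩
        · omega
        · exact nb (Or.inr ⟨h1, w, hw, (div_up hw1 hgh).trans hz1, (div_up hw2 hgh).trans hz2⟩)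
      · refine hmin g (by omega) y ⟨hy, ey, ?_⟩
        rw [hz2]
        rcases bY with h3 | ⟨h3, w, hw, hw1, hw2⟩
        · exact Or.inl h3
        · rcases Finset.mem_insert.1 hw with rfl | hw
          · exact absurd (hz1.symm.trans hw1) hxy
          · exact Or.inr ⟨h3, w, hw, hw1, hw2⟩
    intro g x y v hg hx hy hxy bx bY ex ey
    have ex' : Emp S g x := fun z hz => ex z (Finset.mem_insert_of_mem hz)
    have ey' : Emp S g y := fun z hz => ey z (Finset.mem_insert_of_mem hz)
    by_cases n1 : Bel L S (g + 1) x v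
    · by_cases n2 : Bel L S (g + 1) y v
      · exact hS.i3 g x y v hg hx hy hxy n1 n2 ex' ey'
      · exact aux g y x v hg hy hx hxy.symm bY bx ey' ex' n2
    · exact aux g x y v hg hx hy hxy bx bY ex' ey' n1

def Dd (L : ℕ) (S : Finset (ℕ × ℕ)) (g : ℕ) : Finset ℕ :=
  (S.filter (fun x => g < Hh L x.1)).image (fun x => x.1 / 2 ^ g)

lemma mem_Dd {L : ℕ} {S : Finset (ℕ × ℕ)} {g c : ℕ} :
    c ∈ Dd L S g ↔ ∃ x ∈ S, g < Hh L x.1 ∧ x.1 / 2 ^ g = c := by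
  simp only [Dd, Finset.mem_image, Finset.mem_filter, and_assoc]

/-- a cell with tall row and whose chunk is not in `Dd` is empty -/
lemma Emp_of_not_mem {L : ℕ} {S : Finset (ℕ × ℕ)} {g z : ℕ} (hg : g < Hh L z)
    (h : z / 2 ^ g ∉ Dd L S g) : Emp S g z := by
  intro x hx hxz
  have := Hh_le L z
  exact h (mem_Dd.2 ⟨x, hx, by rw [Hh_congr hxz (by omega)]; exact hg, hxz⟩)

lemma half_div (c g b : ℕ) (hb : b < 2) : ((2 * c + b) * 2 ^ g) / 2 ^ (g + 1) = c := by
  rw [pow_succ, ← Nat.div_div_eq_div_mul, Nat.mul_div_cancel _ (by positivity)]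
  omega

lemma count_step {L R : ℕ} {S : Finset (ℕ × ℕ)} (hS : SInv L R S) (hR : L ≤ R) {g : ℕ}
    (hg : g + 1 < L) : 2 * (Dd L S (g + 1)).card ≤ (Dd L S g).card := by
  have ex : ∀ c ∈ Dd L S (g + 1), ∃ e, (∀ b < 2, 2 * e + b ∈ Dd L S g) ∧
      (e = c ∨ ∃ z v, z / 2 ^ (g + 1) = c ∧ z / 2 ^ L < R ∧ Emp S g z ∧ Bel L S (g + 1) z v ∧
        v < 2 ^ (L - (g + 1)) ∧ e = g * 2 ^ (L - (g + 1)) + v) := by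
    intro c hc
    by_cases hf : ∀ b < 2, 2 * c + b ∈ Dd L S g
    · exact ⟨c, hf, Or.inl rfl⟩
    push Not at hf
    obtain ⟨b, hb, hbn⟩ := hf
    obtain ⟨w, hw, hw1, hw2⟩ := mem_Dd.1 hc
    set z := (2 * c + b) * 2 ^ g with hz
    have hzc : z / 2 ^ (g + 1) = c := half_div c g b hb
    have hzw : z / 2 ^ (g + 1) = w.1 / 2 ^ (g + 1) := by rw [hzc, hw2]
    have hzR : z / 2 ^ L < R := by
      rw [div_up hzw hg.le]; exact hS.hp w hw
    have hHz : Hh L z = Hh L w.1 := Hh_congr hzw hg.le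
    have hzE : Emp S g z := by
      apply Emp_of_not_mem (L := L)
      · omega
      · rw [hz, Nat.mul_div_cancel _ (by positivity)]; exact hbn
    have hzB : Bel L S (g + 1) z (w.2 / 2 ^ (g + 1)) :=
      Or.inr ⟨by omega, w, hw, hzw.symm, rfl⟩
    have hv : w.2 / 2 ^ (g + 1) < 2 ^ (L - (g + 1)) := by
      rw [Nat.div_lt_iff_lt_mul (by positivity), ← pow_add, Nat.sub_add_cancel hg.le]
      exact hS.hq w hw
    set v := w.2 / 2 ^ (g + 1) with hvdef
    refine ⟨g * 2 ^ (L - (g + 1)) + v, ?_, Or.inr ⟨z, v, hzc, hzR, hzE, hzB, hv, rfl⟩⟩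
    intro b' hb'
    by_contra hn
    set s := g * 2 ^ (L - (g + 1)) + v with hs
    set y := (2 * s + b') * 2 ^ g with hy
    have hys : y / 2 ^ (g + 1) = s := half_div s g b' hb'
    have hyrow : y / 2 ^ L = g := by
      have : L = (g + 1) + (L - (g + 1)) := by omega
      rw [this, pow_add, ← Nat.div_div_eq_div_mul, hys, hs, Nat.add_comm,
        Nat.add_mul_div_right _ _ (by positivity), Nat.div_eq_of_lt hv]
      omega
    have hyH : Hh L y = g + 1 := by unfold Hh; rw [hyrow]; omega
    refine hS.i3 g z y v hg hzR (by omega) ?_ hzB (Or.inl ⟨hyH.symm, ?_⟩) hzE ?_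
    · intro h
      have := Hh_congr h hg.le
      omega
    · rw [mod_div hg.le, hys, hs, Nat.add_comm, Nat.add_mul_mod_self_right, Nat.mod_eq_of_lt hv]
    · apply Emp_of_not_mem (L := L)
      · omega
      · rw [hy, Nat.mul_div_cancel _ (by positivity)]; exact hn
  choose! f hf1 hf2 using ex
  have stat : ∀ c ∈ Dd L S (g + 1), ∀ v < 2 ^ (L - (g + 1)), c ≠ g * 2 ^ (L - (g + 1)) + v := by
    intro c hc v hv h
    obtain ⟨w, hw, hw1, hw2⟩ := mem_Dd.1 hc
    have : w.1 / 2 ^ L = g := by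
      have : L = (g + 1) + (L - (g + 1)) := by omega
      rw [this, pow_add, ← Nat.div_div_eq_div_mul, hw2, h, Nat.add_comm,
        Nat.add_mul_div_right _ _ (by positivity), Nat.div_eq_of_lt hv]
      omega
    unfold Hh at hw1
    omega
  have inj : Set.InjOn f (Dd L S (g + 1)) := by
    intro c hc c' hc' hcc
    rcases hf2 c hc with h | ⟨z, v, h1, h2, h3, h4, h5, h6⟩
    · rcases hf2 c' hc' with h' | ⟨z, v, h1, h2, h3, h4, h5, h6⟩
      · omega
      · exact absurd (by rw [← h6, ← hcc, h]) (stat c hc v h5)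
    · rcases hf2 c' hc' with h' | ⟨z', v', h1', h2', h3', h4', h5', h6'⟩
      · exact absurd (by rw [← h6, hcc, h']) (stat c' hc' v h5)
      · have : v = v' := by omega
        subst this
        by_contra hne
        exact hS.i3 g z z' v hg h2 h2' (by omega) h4 h4' h3 h3'
  have hsub : ((Dd L S (g + 1)) ×ˢ Finset.range 2).image (fun x => 2 * f x.1 + x.2) ⊆ Dd L S g := by
    intro d hd
    obtain ⟨x, hx, rfl⟩ := Finset.mem_image.1 hd
    obtain ⟨hx1, hx2⟩ := Finset.mem_product.1 hx
    exact hf1 x.1 hx1 x.2 (Finset.mem_range.1 hx2)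
  have hcard := Finset.card_le_card hsub
  rw [Finset.card_image_of_injOn, Finset.card_product, Finset.card_range] at hcard
  · omega
  · intro x hx y hy hxy
    simp only [Finset.coe_product, Set.mem_prod, Finset.mem_coe, Finset.mem_range] at hx hy
    dsimp only at hxy
    have h2 : x.2 = y.2 := by omega
    have h1 : f x.1 = f y.1 := by omega
    exact Prod.ext (inj hx.1 hy.1 h1) h2

lemma count_all {L R : ℕ} {S : Finset (ℕ × ℕ)} (hS : SInv L R S) (hR : L ≤ R) :
    ∀ g, g < L → 2 ^ g * (Dd L S g).card ≤ S.card := by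
  intro g
  induction g with
  | zero =>
    intro _
    rw [pow_zero, one_mul]
    exact Finset.card_image_le.trans (Finset.card_filter_le _ _)
  | succ g ih =>
    intro hg
    have h1 := ih (by omega)
    have h2 := count_step hS hR hg
    calc 2 ^ (g + 1) * (Dd L S (g + 1)).card = 2 ^ g * (2 * (Dd L S (g + 1)).card) := by ring
      _ ≤ 2 ^ g * (Dd L S g).card := Nat.mul_le_mul_left _ h2
      _ ≤ _ := h1

lemma exists_avail {L A : ℕ} {S : Finset (ℕ × ℕ)} (hL : 1 ≤ L) (hS : SInv L (L + A) S)
    (hc : S.card ≤ A * 2 ^ L) {q : ℕ} (hq : q < 2 ^ L) : ∃ h p, Avail L (L + A) S q h p := by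
  by_contra hn
  push Not at hn
  obtain ⟨l, rfl⟩ := Nat.exists_eq_add_of_le' hL
  have hsub : Finset.Ico (2 * l) (2 * (l + 1 + A)) ⊆ Dd (l + 1) S l := by
    intro i hi
    rw [Finset.mem_Ico] at hi
    by_contra hni
    have hrow : (i * 2 ^ l) / 2 ^ (l + 1) = i / 2 := by
      rw [pow_succ, ← Nat.div_div_eq_div_mul, Nat.mul_div_cancel _ (by positivity)]
    have hH : Hh (l + 1) (i * 2 ^ l) = l + 1 := by unfold Hh; rw [hrow]; omega
    refine hn l (i * 2 ^ l) ⟨by rw [hrow]; omega, ?_, Or.inl ⟨hH.symm, ?_⟩⟩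
    · apply Emp_of_not_mem (L := l + 1)
      · omega
      · rw [Nat.mul_div_cancel _ (by positivity)]; exact hni
    · rw [Nat.div_eq_of_lt hq, Nat.div_eq_of_lt (Nat.mod_lt _ (by positivity))]
  have h1 := Finset.card_le_card hsub
  rw [Nat.card_Ico] at h1
  have h2 := count_all hS (by omega) l (by omega)
  have h3 : 2 ^ l * (2 * (1 + A)) ≤ 2 ^ l * (Dd (l + 1) S l).card :=
    Nat.mul_le_mul_left _ (by omega)
  have h4 : 0 < 2 ^ l := by positivity
  rw [pow_succ] at hc
  nlinarith

lemma cost_le {N : ℕ} (g : Fin N → Option ℝ) (Ψ : ℕ → ℝ) (mono : Monotone Ψ)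
    (h : ∀ i j : Fin N, i < j → (g i).isSome = true → (g j).isSome = true →
      |(g i).getD 0 - (g j).getD 0| ≤ Ψ j - Ψ i) : configCost g ≤ Ψ (N - 1 : ℕ) - Ψ 0 := by
  unfold configCost
  rw [← Fintype.sum_prod_type' (f := fun i j : Fin N =>
    if (g i).isSome = true ∧ (g j).isSome = true ∧ i < j ∧
        (∀ k : Fin N, i < k → k < j → g k = none) then
      |(g i).getD 0 - (g j).getD 0| else 0), ← Finset.sum_filter]
  set F := Finset.univ.filter (fun x : Fin N × Fin N => (g x.1).isSome = true ∧
    (g x.2).isSome = true ∧ x.1 < x.2 ∧ (∀ k : Fin N, x.1 < k → k < x.2 → g k = none)) with hF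
  have hFm : ∀ x, x ∈ F ↔ ((g x.1).isSome = true ∧
    (g x.2).isSome = true ∧ x.1 < x.2 ∧ (∀ k : Fin N, x.1 < k → k < x.2 → g k = none)) := by
    intro x; simp [hF]
  calc ∑ x ∈ F, |(g x.1).getD 0 - (g x.2).getD 0|
      ≤ ∑ x ∈ F, ∑ k ∈ Finset.Ico x.1.1 x.2.1, (Ψ (k + 1) - Ψ k) := by
        apply Finset.sum_le_sum
        intro x hx
        obtain ⟨h1, h2, h3, h4⟩ := (hFm x).1 hx
        rw [Finset.sum_Ico_sub _ (le_of_lt h3)]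
        exact h _ _ h3 h1 h2
    _ = ∑ k ∈ F.biUnion (fun x => Finset.Ico x.1.1 x.2.1), (Ψ (k + 1) - Ψ k) := by
        rw [Finset.sum_biUnion]
        have aux : ∀ x ∈ F, ∀ y ∈ F, ∀ k, k ∈ Finset.Ico x.1.1 x.2.1 → k ∈ Finset.Ico y.1.1 y.2.1 →
            ¬ (x.1 < y.1) ∧ ¬ (x.2 < y.2) := by
          intro x hx y hy k hkx hky
          rw [Finset.mem_Ico] at hkx hky
          obtain ⟨h1, h2, h3, h4⟩ := (hFm x).1 hx
          obtain ⟨h1', h2', h3', h4'⟩ := (hFm y).1 hy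
          constructor
          · intro hlt
            have := h4 y.1 hlt (by rw [Fin.lt_def]; omega)
            rw [this] at h1'; simp at h1'
          · intro hlt
            have := h4' x.2 (by rw [Fin.lt_def]; omega) hlt
            rw [this] at h2; simp at h2
        intro x hx y hy hxy
        rw [Function.onFun, Finset.disjoint_left]
        intro k hkx hky
        have a1 := aux x hx y hy k hkx hky
        have a2 := aux y hy x hx k hky hkx
        apply hxy
        apply Prod.ext
        · exact le_antisymm (not_lt.1 a2.1) (not_lt.1 a1.1)
        · exact le_antisymm (not_lt.1 a2.2) (not_lt.1 a1.2)
    _ ≤ ∑ k ∈ Finset.range (N - 1), (Ψ (k + 1) - Ψ k) := by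
        apply Finset.sum_le_sum_of_subset_of_nonneg
        · intro k hk
          obtain ⟨x, hx, hk⟩ := Finset.mem_biUnion.1 hk
          rw [Finset.mem_Ico] at hk
          have := x.2.2
          rw [Finset.mem_range]; omega
        · intro k _ _
          exact sub_nonneg.2 (mono (Nat.le_succ k))
    _ = _ := by rw [Finset.sum_range_sub]

def fl (L p : ℕ) : ℕ := 2 ^ (Hh L p) * (p / 2 ^ (Hh L p))

lemma fl_mono (L : ℕ) : Monotone (fl L) := by
  intro p p' hpp
  have hr := Nat.div_le_div_right (c := 2 ^ L) hpp
  rcases hr.eq_or_lt with h | h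
  · unfold fl
    have : Hh L p = Hh L p' := by unfold Hh; rw [h]
    rw [this]
    exact Nat.mul_le_mul_left _ (Nat.div_le_div_right hpp)
  · have h1 : fl L p ≤ p := Nat.mul_div_le _ _
    have h2 : p < 2 ^ L * (p / 2 ^ L + 1) := Nat.lt_mul_div_succ p (by positivity)
    have h3 : 2 ^ L * (p / 2 ^ L + 1) ≤ 2 ^ L * (p' / 2 ^ L) := Nat.mul_le_mul_left _ h
    have h4 : 2 ^ L * (p' / 2 ^ L) ≤ fl L p' := by
      unfold fl
      obtain ⟨c, hc⟩ := Nat.exists_eq_add_of_le (Hh_le L p')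
      have : 2 ^ L = 2 ^ (Hh L p') * 2 ^ c := by rw [← pow_add, ← hc]
      rw [this, ← Nat.div_div_eq_div_mul, mul_assoc]
      exact Nat.mul_le_mul_left _ (Nat.mul_div_le _ _)
    omega

def Psi (L : ℕ) (S : Finset (ℕ × ℕ)) (p : ℕ) : ℝ :=
  ((p / 2 ^ L : ℕ) : ℝ) + 2 * (fl L p : ℝ) / 2 ^ L +
    ∑ g ∈ Finset.range L, (2 ^ (g + 1) / 2 ^ L) *
      (((Dd L S g).filter (fun c => c ≤ p / 2 ^ g)).card : ℝ)

lemma cnt_mono (L : ℕ) (S : Finset (ℕ × ℕ)) (g : ℕ) {p p' : ℕ} (h : p ≤ p') :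
    ((Dd L S g).filter (fun c => c ≤ p / 2 ^ g)).card ≤
    ((Dd L S g).filter (fun c => c ≤ p' / 2 ^ g)).card := by
  apply Finset.card_le_card
  intro c hc
  rw [Finset.mem_filter] at hc ⊢
  exact ⟨hc.1, hc.2.trans (Nat.div_le_div_right h)⟩

lemma Psi_mono (L : ℕ) (S : Finset (ℕ × ℕ)) : Monotone (Psi L S) := by
  intro p p' h
  unfold Psi
  have h1 : ((p / 2 ^ L : ℕ) : ℝ) ≤ ((p' / 2 ^ L : ℕ) : ℝ) := by
    exact_mod_cast Nat.div_le_div_right h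
  have h2 : (fl L p : ℝ) ≤ fl L p' := by exact_mod_cast fl_mono L h
  gcongr

lemma Psi_nonneg (L : ℕ) (S : Finset (ℕ × ℕ)) (p : ℕ) : 0 ≤ Psi L S p := by
  unfold Psi; positivity

lemma Psi_le {L A : ℕ} {S : Finset (ℕ × ℕ)} (hS : SInv L (L + A) S)
    (hc : S.card ≤ A * 2 ^ L) {p : ℕ} (hp : p < (L + A) * 2 ^ L) :
    Psi L S p ≤ 3 * (L + A) + 2 * L * A := by
  unfold Psi
  have hN : (0 : ℝ) < 2 ^ L := by positivity
  have h1 : ((p / 2 ^ L : ℕ) : ℝ) ≤ L + A := by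
    have : p / 2 ^ L < L + A := (Nat.div_lt_iff_lt_mul (by positivity)).2 hp
    exact_mod_cast this.le
  have h2 : 2 * (fl L p : ℝ) / 2 ^ L ≤ 2 * (L + A) := by
    have : fl L p ≤ (L + A) * 2 ^ L := (Nat.mul_div_le _ _).trans hp.le
    have : (fl L p : ℝ) ≤ (L + A) * 2 ^ L := by exact_mod_cast this
    rw [div_le_iff₀ hN]; linarith
  have h3 : ∑ g ∈ Finset.range L, ((2 : ℝ) ^ (g + 1) / 2 ^ L) *
      (((Dd L S g).filter (fun c => c ≤ p / 2 ^ g)).card : ℝ) ≤ ∑ g ∈ Finset.range L, 2 * (A : ℝ) := by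
    apply Finset.sum_le_sum
    intro g hg
    rw [Finset.mem_range] at hg
    have c1 := count_all hS (by omega) g hg
    have c2 := Finset.card_filter_le (Dd L S g) (fun c => c ≤ p / 2 ^ g)
    have c3 : 2 ^ g * ((Dd L S g).filter (fun c => c ≤ p / 2 ^ g)).card ≤ A * 2 ^ L :=
      (Nat.mul_le_mul_left _ c2).trans (c1.trans hc)
    have c4 : (2 : ℝ) ^ g * (((Dd L S g).filter (fun c => c ≤ p / 2 ^ g)).card : ℝ) ≤ A * 2 ^ L := by
      exact_mod_cast c3
    rw [div_mul_eq_mul_div, div_le_iff₀ hN, pow_succ]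
    nlinarith
  rw [Finset.sum_const, Finset.card_range, nsmul_eq_mul] at h3
  linarith

lemma pair_le {L R : ℕ} {S : Finset (ℕ × ℕ)} (hS : SInv L R S) {x y : ℕ × ℕ}
    (hx : x ∈ S) (hy : y ∈ S) (hxy : x.1 < y.1) {a b : ℝ} (ha : a ∈ Set.Icc (0 : ℝ) 1)
    (hb : b ∈ Set.Icc (0 : ℝ) 1) (ha1 : (x.2 : ℝ) ≤ a * 2 ^ L) (ha2 : a * 2 ^ L ≤ x.2 + 1)
    (hb1 : (y.2 : ℝ) ≤ b * 2 ^ L) (hb2 : b * 2 ^ L ≤ y.2 + 1) :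
    |a - b| ≤ Psi L S y.1 - Psi L S x.1 := by
  have hN : (0 : ℝ) < 2 ^ L := by positivity
  have mrow : ((x.1 / 2 ^ L : ℕ) : ℝ) ≤ ((y.1 / 2 ^ L : ℕ) : ℝ) := by
    exact_mod_cast Nat.div_le_div_right hxy.le
  have mfl : 2 * (fl L x.1 : ℝ) / 2 ^ L ≤ 2 * (fl L y.1 : ℝ) / 2 ^ L := by
    have h2 : (fl L x.1 : ℝ) ≤ fl L y.1 := by exact_mod_cast fl_mono L hxy.le
    gcongr
  have mterm : ∀ g ∈ Finset.range L, ((2 : ℝ) ^ (g + 1) / 2 ^ L) *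
      (((Dd L S g).filter (fun c => c ≤ x.1 / 2 ^ g)).card : ℝ) ≤ ((2 : ℝ) ^ (g + 1) / 2 ^ L) *
      (((Dd L S g).filter (fun c => c ≤ y.1 / 2 ^ g)).card : ℝ) := by
    intro g _
    have := cnt_mono L S g hxy.le
    gcongr
  have msum := Finset.sum_le_sum mterm
  -- closeness from equality of ancestors
  have close : ∀ g, x.2 / 2 ^ g = y.2 / 2 ^ g → |a - b| ≤ 2 ^ g / 2 ^ L := by
    intro g hg
    have e1 := Nat.div_add_mod x.2 (2 ^ g)
    have e2 := Nat.div_add_mod y.2 (2 ^ g)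
    have l1 := Nat.mod_lt x.2 (show 0 < 2 ^ g by positivity)
    have l2 := Nat.mod_lt y.2 (show 0 < 2 ^ g by positivity)
    rw [hg] at e1
    have n1 : x.2 + 1 ≤ y.2 + 2 ^ g := by omega
    have n2 : y.2 + 1 ≤ x.2 + 2 ^ g := by omega
    have r1 : (x.2 : ℝ) + 1 ≤ y.2 + 2 ^ g := by exact_mod_cast n1
    have r2 : (y.2 : ℝ) + 1 ≤ x.2 + 2 ^ g := by exact_mod_cast n2
    rw [le_div_iff₀ hN, ← abs_of_pos hN, ← abs_mul, abs_le]
    constructor <;> nlinarith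
  unfold Psi
  rcases (Nat.div_le_div_right (c := 2 ^ L) hxy.le).eq_or_lt with hrow | hrow
  swap
  · have : ((x.1 / 2 ^ L : ℕ) : ℝ) + 1 ≤ ((y.1 / 2 ^ L : ℕ) : ℝ) := by exact_mod_cast hrow
    have : |a - b| ≤ 1 := by
      rw [abs_le]; constructor <;> linarith [ha.1, ha.2, hb.1, hb.2]
    linarith
  have hH : Hh L x.1 = Hh L y.1 := by unfold Hh; rw [hrow]
  have hHL := Hh_le L x.1
  by_cases hblk : x.1 / 2 ^ (Hh L x.1) = y.1 / 2 ^ (Hh L x.1)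
  · -- same block
    have hex : ∃ g, x.1 / 2 ^ g = y.1 / 2 ^ g := ⟨_, hblk⟩
    have hg0 := Nat.find_spec hex
    have hgle : Nat.find hex ≤ Hh L x.1 := Nat.find_min' hex hblk
    rcases hgeq : Nat.find hex with _ | g
    · rw [hgeq] at hg0; simp at hg0; omega
    rw [hgeq] at hg0 hgle
    have hne : x.1 / 2 ^ g ≠ y.1 / 2 ^ g := Nat.find_min hex (by omega)
    have hq : x.2 / 2 ^ (g + 1) = y.2 / 2 ^ (g + 1) := by
      rcases hgle.eq_or_lt with h | h
      · have i1 := hS.i1 x hx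
        have i2 := hS.i1 y hy
        rw [← hH] at i2
        rw [h, ← i1, ← i2]
        exact mod_up hblk hHL
      · exact hS.i2 x hx y hy (g + 1) h hg0
    have hcl := close (g + 1) hq
    have hlt : x.1 / 2 ^ g < y.1 / 2 ^ g := lt_of_le_of_ne (Nat.div_le_div_right hxy.le) hne
    have hcnt : ((Dd L S g).filter (fun c => c ≤ x.1 / 2 ^ g)).card + 1 ≤
        ((Dd L S g).filter (fun c => c ≤ y.1 / 2 ^ g)).card := by
      apply Nat.succ_le_of_lt
      apply Finset.card_lt_card
      rw [Finset.ssubset_iff_of_subset]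
      · refine ⟨y.1 / 2 ^ g, ?_, ?_⟩
        · rw [Finset.mem_filter]
          exact ⟨mem_Dd.2 ⟨y, hy, by omega, rfl⟩, le_rfl⟩
        · rw [Finset.mem_filter]; omega
      · intro c hc
        rw [Finset.mem_filter] at hc ⊢
        exact ⟨hc.1, by omega⟩
    have hcnt' : (((Dd L S g).filter (fun c => c ≤ x.1 / 2 ^ g)).card : ℝ) + 1 ≤
        (((Dd L S g).filter (fun c => c ≤ y.1 / 2 ^ g)).card : ℝ) := by exact_mod_cast hcnt
    have hgm : g ∈ Finset.range L := Finset.mem_range.2 (by omega)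
    have hsing := Finset.single_le_sum (f := fun g => ((2 : ℝ) ^ (g + 1) / 2 ^ L) *
      (((Dd L S g).filter (fun c => c ≤ y.1 / 2 ^ g)).card : ℝ) - ((2 : ℝ) ^ (g + 1) / 2 ^ L) *
      (((Dd L S g).filter (fun c => c ≤ x.1 / 2 ^ g)).card : ℝ))
      (fun g hg => sub_nonneg.2 (mterm g hg)) hgm
    rw [Finset.sum_sub_distrib] at hsing
    have hw : (0 : ℝ) < 2 ^ (g + 1) / 2 ^ L := by positivity
    have := mul_le_mul_of_nonneg_left hcnt' hw.le
    linarith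
  · -- different blocks of the same row
    set H := Hh L x.1 with hHdef
    have hlt : x.1 / 2 ^ H < y.1 / 2 ^ H := lt_of_le_of_ne (Nat.div_le_div_right hxy.le) hblk
    have i1 := hS.i1 x hx
    have i2 := hS.i1 y hy
    rw [← hH] at i2
    rw [← hHdef] at i1
    have hfx : fl L x.1 = 2 ^ H * (x.1 / 2 ^ H) := by unfold fl; rw [← hHdef]
    have hfy : fl L y.1 = 2 ^ H * (y.1 / 2 ^ H) := by unfold fl; rw [← hH]
    obtain ⟨c, hc⟩ := Nat.exists_eq_add_of_le hHL
    have hpow : 2 ^ L = 2 ^ H * 2 ^ c := by rw [← pow_add, ← hc]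
    have hLc : L - H = c := by omega
    rw [mod_div hHL, hLc] at i1 i2
    have d1 := Nat.div_add_mod (x.1 / 2 ^ H) (2 ^ c)
    have d2 := Nat.div_add_mod (y.1 / 2 ^ H) (2 ^ c)
    rw [Nat.div_div_eq_div_mul, ← hpow, i1] at d1
    rw [Nat.div_div_eq_div_mul, ← hpow, i2, ← hrow] at d2
    set u := x.2 / 2 ^ H with hu
    set v := y.2 / 2 ^ H with hv
    have huv : u + 1 ≤ v := by omega
    have ex := Nat.div_add_mod x.2 (2 ^ H)
    have ey := Nat.div_add_mod y.2 (2 ^ H)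
    have lx := Nat.mod_lt x.2 (show 0 < 2 ^ H by positivity)
    have ly := Nat.mod_lt y.2 (show 0 < 2 ^ H by positivity)
    rw [← hu] at ex
    rw [← hv] at ey
    have bx1 : 2 ^ H * u ≤ x.2 := by omega
    have bx2 : x.2 + 1 ≤ 2 ^ H * u + 2 ^ H := by omega
    have by1 : 2 ^ H * v ≤ y.2 := by omega
    have by2 : y.2 + 1 ≤ 2 ^ H * v + 2 ^ H := by omega
    have hdiff : y.1 / 2 ^ H + u = x.1 / 2 ^ H + v := by omega
    have rbx1 : (2 : ℝ) ^ H * u ≤ x.2 := by exact_mod_cast bx1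
    have rbx2 : (x.2 : ℝ) + 1 ≤ 2 ^ H * u + 2 ^ H := by exact_mod_cast bx2
    have rby1 : (2 : ℝ) ^ H * v ≤ y.2 := by exact_mod_cast by1
    have rby2 : (y.2 : ℝ) + 1 ≤ 2 ^ H * v + 2 ^ H := by exact_mod_cast by2
    have rdiff : (fl L y.1 : ℝ) + 2 ^ H * u = fl L x.1 + 2 ^ H * v := by
      rw [hfx, hfy]
      have : 2 ^ H * (y.1 / 2 ^ H) + 2 ^ H * u = 2 ^ H * (x.1 / 2 ^ H) + 2 ^ H * v := by
        rw [← mul_add, ← mul_add, hdiff]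
      exact_mod_cast this
    have ruv : (2 : ℝ) ^ H * u + 2 ^ H ≤ 2 ^ H * v := by
      have : 2 ^ H * u + 2 ^ H ≤ 2 ^ H * v := by
        calc 2 ^ H * u + 2 ^ H = 2 ^ H * (u + 1) := by ring
          _ ≤ _ := Nat.mul_le_mul_left _ huv
      exact_mod_cast this
    have hfin : |a - b| ≤ 2 * (fl L y.1 : ℝ) / 2 ^ L - 2 * (fl L x.1 : ℝ) / 2 ^ L := by
      rw [← sub_div, le_div_iff₀ hN, ← abs_of_pos hN, ← abs_mul, abs_le]
      constructor <;> nlinarith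
    linarith

def pick (L R : ℕ) (S : Finset (ℕ × ℕ)) (q : ℕ) : ℕ :=
  if h : ∃ h p, Avail L R S q h p then Classical.choose (Nat.find_spec h) else 0

lemma pick_spec {L R : ℕ} {S : Finset (ℕ × ℕ)} {q : ℕ} (hex : ∃ h p, Avail L R S q h p) :
    ∃ h, Avail L R S q h (pick L R S q) ∧ ∀ h' < h, ∀ p', ¬ Avail L R S q h' p' := by
  refine ⟨Nat.find hex, ?_, ?_⟩
  · unfold pick
    rw [dif_pos hex]
    exact Classical.choose_spec (Nat.find_spec hex)
  · intro h' hh p' hA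
    exact Nat.find_min hex hh ⟨p', hA⟩

def runS (L R : ℕ) (l : List ℕ) : Finset (ℕ × ℕ) :=
  l.foldl (fun S q => insert (pick L R S q, q) S) ∅

lemma runS_append (L R : ℕ) (l : List ℕ) (q : ℕ) :
    runS L R (l ++ [q]) = insert (pick L R (runS L R l) q, q) (runS L R l) := by
  simp [runS]

lemma runS_inv {L A : ℕ} (hL : 1 ≤ L) (l : List ℕ) (hl : l.length ≤ A * 2 ^ L)
    (hq : ∀ q ∈ l, q < 2 ^ L) :
    SInv L (L + A) (runS L (L + A) l) ∧ (runS L (L + A) l).card ≤ l.length := by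
  induction l using List.reverseRecOn with
  | nil => exact ⟨Inv_empty _ _, by simp [runS]⟩
  | append_singleton l q ih =>
    rw [List.length_append, List.length_singleton] at hl
    obtain ⟨h1, h2⟩ := ih (by omega) (fun q hq' => hq q (by simp [hq']))
    have hq0 : q < 2 ^ L := hq q (by simp)
    obtain ⟨h, hA, hmin⟩ := pick_spec (exists_avail hL h1 (by omega) hq0)
    rw [runS_append]
    refine ⟨Inv_step h1 hq0 hA hmin, (Finset.card_insert_le _ _).trans ?_⟩
    rw [List.length_append, List.length_singleton]
    omega

def leaf (L : ℕ) (x : ℝ) : ℕ := min ⌊x * 2 ^ L⌋₊ (2 ^ L - 1)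

lemma leaf_lt (L : ℕ) (x : ℝ) : leaf L x < 2 ^ L := by
  have : 0 < 2 ^ L := by positivity
  unfold leaf; omega

lemma leaf_le {L : ℕ} {x : ℝ} (hx : x ∈ Set.Icc (0 : ℝ) 1) : (leaf L x : ℝ) ≤ x * 2 ^ L := by
  have h : leaf L x ≤ ⌊x * 2 ^ L⌋₊ := min_le_left _ _
  have h2 : ((⌊x * 2 ^ L⌋₊ : ℕ) : ℝ) ≤ x * 2 ^ L :=
    Nat.floor_le (mul_nonneg hx.1 (by positivity))
  have h3 : (leaf L x : ℝ) ≤ (⌊x * 2 ^ L⌋₊ : ℕ) := by exact_mod_cast h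
  linarith

lemma le_leaf {L : ℕ} {x : ℝ} (hx : x ∈ Set.Icc (0 : ℝ) 1) : x * 2 ^ L ≤ leaf L x + 1 := by
  have hN : (0 : ℝ) < 2 ^ L := by positivity
  rcases le_total ⌊x * 2 ^ L⌋₊ (2 ^ L - 1) with h | h
  · have : leaf L x = ⌊x * 2 ^ L⌋₊ := min_eq_left h
    rw [this]
    exact (Nat.lt_floor_add_one _).le
  · have h0 : leaf L x = 2 ^ L - 1 := min_eq_right h
    have h1 : leaf L x + 1 = 2 ^ L := by
      have : 0 < 2 ^ L := by positivity
      omega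
    have h2 : (leaf L x : ℝ) + 1 = 2 ^ L := by exact_mod_cast h1
    rw [h2]
    nlinarith [hx.2]

def strat0 (L A : ℕ) (hA : 1 ≤ A) (l : List ℝ) : Fin ((L + A) * 2 ^ L) :=
  ⟨pick L (L + A) (runS L (L + A) (l.dropLast.map (leaf L))) (leaf L (l.getLast?.getD 0)) %
    ((L + A) * 2 ^ L), Nat.mod_lt _ (by positivity)⟩

lemma cost_final {n m : ℕ} (a : Fin n → ℝ) (pl : Fin n → Fin m) (P : ℕ → ℝ) (B : ℝ)
    (ha : ∀ t, a t ∈ Set.Icc (0 : ℝ) 1) (hB0 : 0 ≤ B) (P0 : ∀ p, 0 ≤ P p) (Pm : Monotone P)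
    (hle : ∀ p, p < m → P p ≤ B)
    (hpair : ∀ t s, (pl t).1 < (pl s).1 → |a t - a s| ≤ P (pl s).1 - P (pl t).1) :
    configCost (withSentinels a pl) ≤ B + 2 := by
  set Ψ : ℕ → ℝ := fun i => if i = 0 then 0 else if i ≤ m then 1 + P (i - 1) else B + 2
    with hΨ
  have hΨ0 : Ψ 0 = 0 := by simp [hΨ]
  have hΨm : ∀ p, p < m → Ψ (p + 1) = 1 + P p := by
    intro p hp
    have : p + 1 ≤ m := hp
    simp [hΨ, this]
  have hΨl : Ψ (m + 1) = B + 2 := by simp [hΨ]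
  have mono : Monotone Ψ := by
    intro i j hij
    simp only [hΨ]
    have n0 := P0 (j - 1)
    split_ifs with h1 h2 h3 h4 h5 h6 h7
    all_goals first
      | omega
      | linarith
      | skip
    · have := Pm (show i - 1 ≤ j - 1 by omega)
      linarith
    · have := hle (i - 1) (by omega)
      linarith
  have key := cost_le (withSentinels a pl) Ψ mono ?_
  · have e : m + 2 - 1 = m + 1 := by omega
    rw [e, hΨl, hΨ0] at key
    linarith
  -- description of the configuration
  have desc : ∀ i : Fin (m + 2), (withSentinels a pl i).isSome = true →
      (i.1 = 0 ∧ (withSentinels a pl i).getD 0 = 0) ∨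
      (i.1 = m + 1 ∧ (withSentinels a pl i).getD 0 = 1) ∨
      (∃ t, (pl t).1 + 1 = i.1 ∧ (withSentinels a pl i).getD 0 = a t) := by
    intro i hi
    unfold withSentinels at hi ⊢
    split_ifs at hi ⊢ with h1 h2 h3
    · left; exact ⟨h1, rfl⟩
    · right; left; exact ⟨h2, rfl⟩
    · right; right; exact ⟨h3.choose, h3.choose_spec, rfl⟩
    · simp at hi
  intro i j hij hi hj
  rw [Fin.lt_def] at hij
  have hj2 := j.2
  rcases desc i hi with ⟨i1, i2⟩ | ⟨i1, i2⟩ | ⟨t, i1, i2⟩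
  · rcases desc j hj with ⟨j1, j2⟩ | ⟨j1, j2⟩ | ⟨s, j1, j2⟩
    · omega
    · rw [i2, j2, i1, j1, hΨ0, hΨl]; norm_num; linarith
    · rw [i2, j2, i1, ← j1, hΨ0, hΨm _ (pl s).2]
      have := P0 (pl s).1
      rw [abs_le]; constructor <;> linarith [(ha s).1, (ha s).2]
  · omega
  · rcases desc j hj with ⟨j1, j2⟩ | ⟨j1, j2⟩ | ⟨s, j1, j2⟩
    · omega
    · rw [i2, j2, j1, ← i1, hΨl, hΨm _ (pl t).2]
      have := hle _ (pl t).2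
      rw [abs_le]; constructor <;> linarith [(ha t).1, (ha t).2]
    · rw [i2, j2, ← j1, ← i1, hΨm _ (pl t).2, hΨm _ (pl s).2]
      have := hpair t s (by omega)
      linarith

lemma main_alg {L A n : ℕ} (hL : 1 ≤ L) (hA : 1 ≤ A) (hn : n = A * 2 ^ L) (a : Fin n → ℝ)
    (ha : ∀ t, a t ∈ Set.Icc (0 : ℝ) 1) :
    Function.Injective (place (strat0 L A hA) a) ∧
    configCost (withSentinels a (place (strat0 L A hA) a)) ≤ 3 * (L + A) + 2 * L * A + 2 := by
  set pl := place (strat0 L A hA) a with hpl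
  set St : ℕ → Finset (ℕ × ℕ) :=
    fun t => runS L (L + A) (((List.ofFn a).take t).map (leaf L)) with hSt
  have hinv : ∀ t, t ≤ n → SInv L (L + A) (St t) ∧ (St t).card ≤ t := by
    intro t ht
    have := runS_inv (A := A) hL (((List.ofFn a).take t).map (leaf L)) (by simp; omega) (by
      intro q hq
      obtain ⟨x, _, rfl⟩ := List.mem_map.1 hq
      exact leaf_lt L x)
    refine ⟨this.1, this.2.trans ?_⟩
    simp
  have htake : ∀ t : Fin n, (List.ofFn a).take (t.1 + 1) = (List.ofFn a).take t.1 ++ [a t] := by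
    intro t
    rw [← List.take_append_getElem (by simp)]
    simp
  have hav : ∀ t : Fin n, ∃ h p, Avail L (L + A) (St t) (leaf L (a t)) h p := by
    intro t
    have ht := t.2
    obtain ⟨h1, h2⟩ := hinv t t.2.le
    exact exists_avail hL h1 (by omega) (leaf_lt L _)
  have hplv : ∀ t : Fin n, (pl t).1 = pick L (L + A) (St t) (leaf L (a t)) := by
    intro t
    obtain ⟨h, hA', _⟩ := pick_spec (hav t)
    have hlt := (Nat.div_lt_iff_lt_mul (by positivity)).1 hA'.1
    rw [hpl]
    simp only [place, strat0, htake t, List.dropLast_concat, List.getLast?_concat, Option.getD_some]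
    exact Nat.mod_eq_of_lt hlt
  have hstep : ∀ t : Fin n, St (t.1 + 1) = insert ((pl t).1, leaf L (a t)) (St t) := by
    intro t
    rw [hplv t]
    simp only [hSt, htake t, List.map_append, List.map_cons, List.map_nil, runS_append]
  have hmem : ∀ t : Fin n, ∀ s, t.1 < s → s ≤ n → ((pl t).1, leaf L (a t)) ∈ St s := by
    intro t s hts
    induction s, hts using Nat.le_induction with
    | base =>
      intro _
      have := hstep t
      simp only [Nat.succ_eq_add_one, this]
      exact Finset.mem_insert_self _ _
    | succ s hs ih =>
      intro hsn
      have := hstep ⟨s, by omega⟩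
      simp only at this
      rw [this]
      exact Finset.mem_insert_of_mem (ih (by omega))
  have hne : ∀ s t : Fin n, s < t → pl s ≠ pl t := by
    intro s t hst heq
    obtain ⟨h, hA', _⟩ := pick_spec (hav t)
    have := hA'.2.1 _ (hmem s t hst t.2.le)
    apply this
    rw [← hplv t, heq]
  have hinj : Function.Injective pl := by
    intro s t hst
    rcases lt_trichotomy s t with h | h | h
    · exact absurd hst (hne s t h)
    · exact h
    · exact absurd hst.symm (hne t s h)
  refine ⟨hinj, ?_⟩
  obtain ⟨hI, hcard⟩ := hinv n le_rfl
  refine cost_final a pl (Psi L (St n)) (3 * (L + A) + 2 * L * A) ha (by positivity)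
    (Psi_nonneg L (St n)) (Psi_mono L (St n)) (fun p hp => Psi_le hI (by omega) hp) ?_
  intro t s hts
  have := pair_le hI (hmem t n t.2 le_rfl) (hmem s n s.2 le_rfl) (by dsimp only; omega)
    (ha t) (ha s) (leaf_le (ha t)) (le_leaf (ha t)) (leaf_le (ha s)) (le_leaf (ha s))
  dsimp only at this
  linarith

theorem statement3 :
    ∃ C : ℝ, 0 < C ∧
      ∀ k j : ℕ, 1 ≤ k → (2 : ℕ) ^ j ≤ k →
        ∃ m : ℕ,
          (m : ℝ) ≤ ((2 : ℝ) ^ k / 2 ^ j) * Real.logb 2 ((2 : ℝ) ^ k / 2 ^ j) + 2 ^ k ∧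
          ((2 : ℝ) ^ k / 2 ^ j) * Real.logb 2 ((2 : ℝ) ^ k / 2 ^ j) + 2 ^ k ≤
            C * 2 ^ k * Real.logb 2 ((2 : ℝ) ^ k) / 2 ^ j ∧
          ∃ strat : List ℝ → Fin m,
            ∀ a : Fin (2 ^ k) → ℝ, (∀ t, a t ∈ Set.Icc (0 : ℝ) 1) →
              Function.Injective (place strat a) ∧
              configCost (withSentinels a (place strat a)) ≤
                C * 2 ^ j * Real.logb 2 ((2 : ℝ) ^ k) := by
  refine ⟨10, by norm_num, ?_⟩
  intro k j hk hj
  have hjk : j < k := lt_of_lt_of_le Nat.lt_two_pow_self hj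
  obtain ⟨L, rfl⟩ := Nat.exists_eq_add_of_le hjk.le
  have hL : 1 ≤ L := by omega
  have hdiv : (2 : ℝ) ^ (j + L) / 2 ^ j = 2 ^ L := by
    rw [pow_add]; field_simp
  have hlog : ∀ i : ℕ, Real.logb 2 ((2 : ℝ) ^ i) = i := by
    intro i
    rw [Real.logb_pow, Real.logb_self_eq_one (by norm_num), mul_one]
  have hjr : (2 : ℝ) ^ j ≤ (j : ℝ) + L := by exact_mod_cast hj
  have h1 : (1 : ℝ) ≤ 2 ^ j := one_le_pow₀ (by norm_num)
  have hLr : (1 : ℝ) ≤ L := by exact_mod_cast hL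
  have hN : (0 : ℝ) < 2 ^ L := by positivity
  have hj0 : (0 : ℝ) ≤ j := by positivity
  have hA : 1 ≤ 2 ^ j := Nat.one_le_two_pow
  refine ⟨(L + 2 ^ j) * 2 ^ L, ?_, ?_, strat0 L (2 ^ j) hA, ?_⟩
  · rw [hdiv, hlog, pow_add]
    push_cast
    linarith
  · rw [hdiv, hlog, hlog]
    have e : (10 : ℝ) * 2 ^ (j + L) * ((j + L : ℕ) : ℝ) / 2 ^ j = 10 * 2 ^ L * (j + L) := by
      rw [← hdiv]; push_cast; ring
    rw [e, pow_add]
    nlinarith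
  · intro a ha
    obtain ⟨h2, h3⟩ := main_alg hL hA (by rw [pow_add]) a ha
    refine ⟨h2, h3.trans ?_⟩
    rw [hlog]
    push_cast
    nlinarith [mul_nonneg hj0 (sub_nonneg.2 h1), mul_nonneg (sub_nonneg.2 hLr) (sub_nonneg.2 h1)]
end
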